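/- For all integers N ≥ 1 and M with 1 ≤ M ≤ N, the function f_{N,M} is strictly decreasing wherever it is positive: for all 0 ≤ t1 < t2, if f_{N,M}(t2) > 0 then f_{N,M}(t1) > f_{N,M}(t2). -/

import Mathlib

open Real Filter

/-- Likelihood ratio ℓ_N(K,t). -/
noncomputable def ell (q0 ρH ρL lam : ℝ) (N K : ℕ) (t : ℝ) : ℝ :=
  (q0 / (1 - q0)) * (ρH / ρL) ^ K *
    ((1 - ρH * (1 - Real.exp (-lam * t))) / (1 - ρL * (1 - Real.exp (-lam * t)))) ^ (N - K)

/-- Belief of good type conditional on state, P_ρ(t). -/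
noncomputable def Pst (ρ lam t : ℝ) : ℝ :=
  ρ * Real.exp (-lam * t) / (ρ * Real.exp (-lam * t) + 1 - ρ)

/-- Posterior probability of state H, Q_N(K,t). -/
noncomputable def Q (q0 ρH ρL lam : ℝ) (N K : ℕ) (t : ℝ) : ℝ :=
  ell q0 ρH ρL lam N K t / (1 + ell q0 ρH ρL lam N K t)

/-- Belief of good type G_N(K,t). -/
noncomputable def G (q0 ρH ρL lam : ℝ) (N K : ℕ) (t : ℝ) : ℝ :=
  Q q0 ρH ρL lam N K t * Pst ρH lam t + (1 - Q q0 ρH ρL lam N K t) * Pst ρL lam t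

/-- The function f_{N,M}(t). -/
noncomputable def fNM (q0 ρH ρL lam r z s g : ℝ) (N M : ℕ) (t : ℝ) : ℝ :=
  G q0 ρH ρL lam N (M - 1) t * lam *
    (z + g / r - s / r + ((N : ℝ) - (M : ℝ)) * (G q0 ρH ρL lam N M t * g / r - s / r))

theorem exp_neg_mul_mem_Ioc {lam t : ℝ} (hlam : 0 < lam) (ht : 0 ≤ t) :
    Real.exp (-lam * t) ∈ Set.Ioc (0 : ℝ) 1 :=
  ⟨Real.exp_pos _, Real.exp_le_one_iff.2 (by nlinarith [mul_nonneg hlam.le ht])⟩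

theorem Pst_pos {ρ : ℝ} (h0 : 0 < ρ) (h1 : ρ < 1) (lam t : ℝ) : 0 < Pst ρ lam t := by
  have he := mul_pos h0 (Real.exp_pos (-lam * t))
  exact div_pos he (by linarith)

theorem Pst_strictAnti {ρ lam : ℝ} (h0 : 0 < ρ) (h1 : ρ < 1) (hlam : 0 < lam) :
    StrictAnti (Pst ρ lam) := by
  intro t1 t2 ht
  have he1 := mul_pos h0 (Real.exp_pos (-lam * t1))
  have he2 := mul_pos h0 (Real.exp_pos (-lam * t2))
  have he : ρ * Real.exp (-lam * t2) < ρ * Real.exp (-lam * t1) :=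
    mul_lt_mul_of_pos_left (Real.exp_lt_exp.2 (by nlinarith)) h0
  unfold Pst
  rw [div_lt_div_iff₀ (by linarith) (by linarith)]
  nlinarith [mul_lt_mul_of_pos_right he (sub_pos.2 h1)]

theorem Pst_le_Pst {ρL ρH : ℝ} (hρL : 0 < ρL) (hρ : ρL < ρH) (hρH : ρH < 1) (lam t : ℝ) :
    Pst ρL lam t ≤ Pst ρH lam t := by
  have he := Real.exp_pos (-lam * t)
  have heL := mul_pos hρL he
  have heH := mul_pos (hρL.trans hρ) he
  unfold Pst
  rw [div_le_div_iff₀ (by linarith) (by linarith)]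
  nlinarith [mul_pos (sub_pos.2 hρ) he]

theorem one_sub_mul_one_sub_pos {ρ e : ℝ} (h0 : 0 < ρ) (h1 : ρ < 1) (he : e ∈ Set.Ioc (0 : ℝ) 1) :
    0 < 1 - ρ * (1 - e) := by
  nlinarith [mul_pos h0 he.1]

theorem ell_pos {q0 ρH ρL lam t : ℝ} (hlam : 0 < lam) (hq0 : 0 < q0) (hq1 : q0 < 1)
    (hρL : 0 < ρL) (hρ : ρL < ρH) (hρH : ρH < 1) (N K : ℕ) (ht : 0 ≤ t) :
    0 < ell q0 ρH ρL lam N K t := by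
  have he := exp_neg_mul_mem_Ioc hlam ht
  have hρH0 := hρL.trans hρ
  have := one_sub_mul_one_sub_pos hρH0 hρH he
  have := one_sub_mul_one_sub_pos hρL (hρ.trans hρH) he
  have := sub_pos.2 hq1
  unfold ell
  positivity

theorem ell_antitoneOn {q0 ρH ρL lam : ℝ} (hlam : 0 < lam) (hq0 : 0 < q0) (hq1 : q0 < 1)
    (hρL : 0 < ρL) (hρ : ρL < ρH) (hρH : ρH < 1) (N K : ℕ) :
    AntitoneOn (ell q0 ρH ρL lam N K) (Set.Ici 0) := by
  intro t1 ht1 t2 ht2 ht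
  have he1 := exp_neg_mul_mem_Ioc hlam ht1
  have he2 := exp_neg_mul_mem_Ioc hlam ht2
  have he : Real.exp (-lam * t2) ≤ Real.exp (-lam * t1) := Real.exp_le_exp.2 (by nlinarith)
  have hρH0 := hρL.trans hρ
  have hH2 := one_sub_mul_one_sub_pos hρH0 hρH he2
  have hL1 := one_sub_mul_one_sub_pos hρL (hρ.trans hρH) he1
  have hL2 := one_sub_mul_one_sub_pos hρL (hρ.trans hρH) he2
  have hq := sub_pos.2 hq1
  unfold ell
  refine mul_le_mul_of_nonneg_left (pow_le_pow_left₀ (div_pos hH2 hL2).le ?_ _) (by positivity)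
  rw [div_le_div_iff₀ hL2 hL1]
  nlinarith [mul_nonneg (sub_nonneg.2 hρ.le) (sub_nonneg.2 he)]

theorem Q_mem_Icc {q0 ρH ρL lam t : ℝ} {N K : ℕ} (h : 0 < ell q0 ρH ρL lam N K t) :
    Q q0 ρH ρL lam N K t ∈ Set.Icc (0 : ℝ) 1 :=
  ⟨div_nonneg h.le (by linarith), div_le_one_of_le₀ (by linarith) (by linarith)⟩

theorem G_pos {q0 ρH ρL lam t : ℝ} (hlam : 0 < lam) (hq0 : 0 < q0) (hq1 : q0 < 1)
    (hρL : 0 < ρL) (hρ : ρL < ρH) (hρH : ρH < 1) (N K : ℕ) (ht : 0 ≤ t) :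
    0 < G q0 ρH ρL lam N K t := by
  obtain ⟨hQ, -⟩ := Q_mem_Icc (ell_pos hlam hq0 hq1 hρL hρ hρH N K ht)
  have hP := Pst_le_Pst hρL hρ hρH lam t
  have hL := Pst_pos hρL (hρ.trans hρH) lam t
  unfold G
  nlinarith [mul_nonneg hQ (sub_nonneg.2 hP)]

theorem G_strictAntiOn {q0 ρH ρL lam : ℝ} (hlam : 0 < lam) (hq0 : 0 < q0) (hq1 : q0 < 1)
    (hρL : 0 < ρL) (hρ : ρL < ρH) (hρH : ρH < 1) (N K : ℕ) :
    StrictAntiOn (G q0 ρH ρL lam N K) (Set.Ici 0) := by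
  intro t1 ht1 t2 ht2 ht
  have hl1 := ell_pos hlam hq0 hq1 hρL hρ hρH N K ht1
  have hl2 := ell_pos hlam hq0 hq1 hρL hρ hρH N K ht2
  have hQ : Q q0 ρH ρL lam N K t2 ≤ Q q0 ρH ρL lam N K t1 := by
    have := ell_antitoneOn hlam hq0 hq1 hρL hρ hρH N K ht1 ht2 ht.le
    unfold Q
    rw [div_le_div_iff₀ (by linarith) (by linarith)]
    linarith
  obtain ⟨hQ0, hQ1⟩ := Q_mem_Icc hl2
  have hP := Pst_le_Pst hρL hρ hρH lam t1
  have hPL := Pst_strictAnti hρL (hρ.trans hρH) hlam ht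
  have hPH := Pst_strictAnti (hρL.trans hρ) hρH hlam ht
  calc G q0 ρH ρL lam N K t2
      < Q q0 ρH ρL lam N K t2 * Pst ρH lam t1 + (1 - Q q0 ρH ρL lam N K t2) * Pst ρL lam t1 := by
        unfold G
        rcases hQ0.eq_or_lt with h | h
        · rw [← h]
          linarith
        · nlinarith [mul_lt_mul_of_pos_left hPH h,
            mul_le_mul_of_nonneg_left hPL.le (sub_nonneg.2 hQ1)]
    _ ≤ G q0 ρH ρL lam N K t1 := by
        unfold G
        nlinarith [mul_nonneg (sub_nonneg.2 hQ) (sub_nonneg.2 hP)]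

/-- f_{N,M} is strictly decreasing wherever it is positive. -/
theorem f_strictAnti_where_positive
    (lam q0 ρH ρL r z s g : ℝ) (hlam : 0 < lam) (hq0 : 0 < q0) (hq1 : q0 < 1)
    (hρL : 0 < ρL) (hρ : ρL < ρH) (hρH : ρH < 1)
    (hr : 0 < r) (hz : 0 < z) (hs : 0 < s) (hg : g = lam * z)
    (hgs : ρH * g > s) (hsg : s > ρL * g)
    (N M : ℕ) (hN : 1 ≤ N) (hM1 : 1 ≤ M) (hMN : M ≤ N) :
    ∀ t1 t2 : ℝ, 0 ≤ t1 → t1 < t2 →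
      0 < fNM q0 ρH ρL lam r z s g N M t2 →
      fNM q0 ρH ρL lam r z s g N M t2 < fNM q0 ρH ρL lam r z s g N M t1 := by
  intro t1 t2 ht1 ht hf
  have ht2 : 0 ≤ t2 := ht1.trans ht.le
  have hG2 := G_pos hlam hq0 hq1 hρL hρ hρH N (M - 1) ht2
  have hG := G_strictAntiOn hlam hq0 hq1 hρL hρ hρH N (M - 1) ht1 ht2 ht
  have hGM := G_strictAntiOn hlam hq0 hq1 hρL hρ hρH N M ht1 ht2 ht
  have hg0 : 0 < g := hg ▸ mul_pos hlam hz
  have hNM : (0 : ℝ) ≤ (N : ℝ) - (M : ℝ) := sub_nonneg.2 (by exact_mod_cast hMN)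
  unfold fNM at hf ⊢
  have hB := pos_of_mul_pos_right hf (mul_pos hG2 hlam).le
  refine mul_lt_mul (mul_lt_mul_of_pos_right hG hlam) ?_ hB
    (mul_pos (hG2.trans hG) hlam).le
  gcongr
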